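/- Let b > 0, δ > 0, η > 0 and 0 ≤ v < 1 be real constants, let y : [0,1] × [0,∞) → ℝ be continuously differentiable with y(0,t) = y(1,t) = 0 for all t ≥ 0, and define E(t) = ∫₀¹ [ (1/2) y_t(x,t)² + (1/2)(1−v²) y_x(x,t)² + (b/8) y_x(x,t)⁴ ] dx. Then for every t ≥ 0, ∫₀¹ [ y(x,t) y_t(x,t) + δ y(x,t)² + (η/4) y_x(x,t)⁴ ] dx ≤ max{ (1 + 2δ/π)/(π(1 − v²)), 2η/b } · E(t). -/

import Mathlib

open Real

/-- Partial derivative with respect to the first (spatial) variable. -/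
noncomputable def pdx (y : ℝ → ℝ → ℝ) (x t : ℝ) : ℝ := deriv (fun x' => y x' t) x

/-- Partial derivative with respect to the second (time) variable. -/
noncomputable def pdt (y : ℝ → ℝ → ℝ) (x t : ℝ) : ℝ := deriv (fun t' => y x t') t

/-- Dirichlet eigenvalue bound on the unit interval, below the optimal constant. -/
theorem sq_mul_integral_sq_le_of_lt_pi {f f' : ℝ → ℝ} (hf : ∀ x, HasDerivAt f (f' x) x)
    (hf' : Continuous f') (h0 : f 0 = 0) (h1 : f 1 = 0) {k : ℝ} (hk0 : 0 < k) (hk : k < π) :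
    k ^ 2 * ∫ x in (0 : ℝ)..1, f x ^ 2 ≤ ∫ x in (0 : ℝ)..1, f' x ^ 2 := by
  have hfc : Continuous f := continuous_iff_continuousAt.2 fun x => (hf x).continuousAt
  have hcos : ∀ x ∈ Set.uIcc (0 : ℝ) 1, cos (k * (x - 1 / 2)) ≠ 0 := by
    intro x hx
    rw [Set.uIcc_of_le zero_le_one] at hx
    refine (cos_pos_of_mem_Ioo ⟨?_, ?_⟩).ne' <;> nlinarith [hx.1, hx.2]
  have htan : ContinuousOn (fun x => tan (k * (x - 1 / 2))) (Set.uIcc 0 1) :=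
    fun x hx => ((continuousAt_tan.2 (hcos x hx)).comp (f := fun x : ℝ => k * (x - 1 / 2))
      (by fun_prop)).continuousWithinAt
  have hgi : IntervalIntegrable (fun x => k * (2 * f x * f' x * tan (k * (x - 1 / 2)) +
      k * f x ^ 2 * (1 + tan (k * (x - 1 / 2)) ^ 2))) MeasureTheory.volume 0 1 :=
    ContinuousOn.intervalIntegrable (by fun_prop)
  have hd : ∀ x ∈ Set.uIcc (0 : ℝ) 1,
      HasDerivAt (fun x => k * (f x ^ 2 * tan (k * (x - 1 / 2))))
        (k * (2 * f x * f' x * tan (k * (x - 1 / 2)) +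
          k * f x ^ 2 * (1 + tan (k * (x - 1 / 2)) ^ 2))) x := by
    intro x hx
    have hlin : HasDerivAt (fun x : ℝ => k * (x - 1 / 2)) k x := by
      simpa only [id, mul_one] using ((hasDerivAt_id x).sub_const (1 / 2)).const_mul k
    refine ((((hf x).pow 2).mul
      ((hasDerivAt_tan (hcos x hx)).comp x hlin)).const_mul k).congr_deriv ?_
    rw [← inv_one_add_tan_sq (hcos x hx)]
    simp only [Function.comp_apply, Pi.pow_apply, one_div, inv_inv]
    push_cast
    ring
  have hzero := intervalIntegral.integral_eq_sub_of_hasDerivAt hd hgi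
  simp only [h0, h1, ne_eq, OfNat.ofNat_ne_zero, not_false_eq_true, zero_pow, zero_mul,
    mul_zero, sub_zero] at hzero
  have i1 : IntervalIntegrable (fun x => k ^ 2 * f x ^ 2) MeasureTheory.volume 0 1 :=
    Continuous.intervalIntegrable (by fun_prop) _ _
  have i2 : IntervalIntegrable (fun x => f' x ^ 2) MeasureTheory.volume 0 1 :=
    Continuous.intervalIntegrable (by fun_prop) _ _
  rw [← intervalIntegral.integral_const_mul]
  calc ∫ x in (0 : ℝ)..1, k ^ 2 * f x ^ 2
      ≤ ∫ x in (0 : ℝ)..1, (f' x ^ 2 + k * (2 * f x * f' x * tan (k * (x - 1 / 2)) +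
          k * f x ^ 2 * (1 + tan (k * (x - 1 / 2)) ^ 2))) := by
        refine intervalIntegral.integral_mono_on zero_le_one i1 (i2.add hgi) fun x _ => ?_
        nlinarith [sq_nonneg (f' x + k * f x * tan (k * (x - 1 / 2)))]
    _ = ∫ x in (0 : ℝ)..1, f' x ^ 2 := by
        rw [intervalIntegral.integral_add i2 hgi, hzero, add_zero]

/-- Wirtinger's inequality on the unit interval with Dirichlet boundary conditions. -/
theorem pi_sq_mul_integral_sq_le {f f' : ℝ → ℝ} (hf : ∀ x, HasDerivAt f (f' x) x)
    (hf' : Continuous f') (h0 : f 0 = 0) (h1 : f 1 = 0) :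
    π ^ 2 * ∫ x in (0 : ℝ)..1, f x ^ 2 ≤ ∫ x in (0 : ℝ)..1, f' x ^ 2 := by
  have hlim : Filter.Tendsto (fun k : ℝ => k ^ 2 * ∫ x in (0 : ℝ)..1, f x ^ 2)
      (nhdsWithin π (Set.Iio π)) (nhds (π ^ 2 * ∫ x in (0 : ℝ)..1, f x ^ 2)) :=
    (Continuous.tendsto (by fun_prop) π).mono_left nhdsWithin_le_nhds
  refine le_of_tendsto hlim ?_
  filter_upwards [Ioo_mem_nhdsLT pi_pos] with k hk
  exact sq_mul_integral_sq_le_of_lt_pi hf hf' h0 h1 hk.1 hk.2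

theorem hasDerivAt_pdx {y : ℝ → ℝ → ℝ} (hy : ContDiff ℝ 1 (Function.uncurry y)) (x t : ℝ) :
    HasDerivAt (fun x' => y x' t) (fderiv ℝ (Function.uncurry y) (x, t) (1, 0)) x :=
  ((hy.differentiable one_ne_zero) (x, t)).hasFDerivAt.comp_hasDerivAt (f := fun x' => (x', t)) x
    ((hasDerivAt_id x).prodMk (hasDerivAt_const x t))

theorem hasDerivAt_pdt {y : ℝ → ℝ → ℝ} (hy : ContDiff ℝ 1 (Function.uncurry y)) (x t : ℝ) :
    HasDerivAt (fun t' => y x t') (fderiv ℝ (Function.uncurry y) (x, t) (0, 1)) t :=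
  ((hy.differentiable one_ne_zero) (x, t)).hasFDerivAt.comp_hasDerivAt (f := fun t' => (x, t')) t
    ((hasDerivAt_const t x).prodMk (hasDerivAt_id t))

theorem continuous_pdx {y : ℝ → ℝ → ℝ} (hy : ContDiff ℝ 1 (Function.uncurry y)) (t : ℝ) :
    Continuous fun x => pdx y x t := by
  have h := hy.continuous_fderiv one_ne_zero
  simp only [pdx, (hasDerivAt_pdx hy _ _).deriv]
  fun_prop

theorem continuous_pdt {y : ℝ → ℝ → ℝ} (hy : ContDiff ℝ 1 (Function.uncurry y)) (t : ℝ) :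
    Continuous fun x => pdt y x t := by
  have h := hy.continuous_fderiv one_ne_zero
  simp only [pdt, (hasDerivAt_pdt hy _ _).deriv]
  fun_prop

/-- The cross term of the Lyapunov function is bounded by a multiple of the
energy `E`. -/
theorem stmt_10 (b δ η v : ℝ) (hb : 0 < b) (hδ : 0 < δ) (hη : 0 < η)
    (hv0 : 0 ≤ v) (hv1 : v < 1)
    (y : ℝ → ℝ → ℝ)
    (hy : ContDiff ℝ 1 (Function.uncurry y))
    (hbc : ∀ t : ℝ, 0 ≤ t → y 0 t = 0 ∧ y 1 t = 0)
    (E : ℝ → ℝ)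
    (hE : ∀ t : ℝ, E t = ∫ x in (0:ℝ)..1,
      ((1/2) * (pdt y x t) ^ 2 + (1/2) * (1 - v ^ 2) * (pdx y x t) ^ 2
        + (b/8) * (pdx y x t) ^ 4)) :
    ∀ t : ℝ, 0 ≤ t →
      (∫ x in (0:ℝ)..1,
        (y x t * pdt y x t + δ * (y x t) ^ 2 + (η/4) * (pdx y x t) ^ 4))
        ≤ max ((1 + 2 * δ / π) / (π * (1 - v ^ 2))) (2 * η / b) * E t := by
  intro t ht
  obtain ⟨h0, h1⟩ := hbc t ht
  have hx := continuous_pdx hy t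
  have ht' := continuous_pdt hy t
  have hdx : ∀ x, HasDerivAt (fun x' => y x' t) (pdx y x t) x := fun x =>
    (hasDerivAt_pdx hy x t).differentiableAt.hasDerivAt
  have hyc : Continuous fun x => y x t :=
    continuous_iff_continuousAt.2 fun x => (hdx x).continuousAt
  have hW := pi_sq_mul_integral_sq_le hdx hx h0 h1
  have hπ := pi_pos
  have hw : 0 < 1 - v ^ 2 := by nlinarith
  set C := max ((1 + 2 * δ / π) / (π * (1 - v ^ 2))) (2 * η / b)
  have hC1 : 1 / (2 * π) + δ / π ^ 2 ≤ C * ((1 / 2) * (1 - v ^ 2)) := by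
    calc 1 / (2 * π) + δ / π ^ 2
        = (1 + 2 * δ / π) / (π * (1 - v ^ 2)) * ((1 / 2) * (1 - v ^ 2)) := by
          field_simp
      _ ≤ _ := mul_le_mul_of_nonneg_right (le_max_left _ _) (by positivity)
  have hC0 : 0 ≤ C := (by positivity : 0 ≤ 2 * η / b).trans (le_max_right _ _)
  have hC2 : 1 / (2 * π) ≤ C * (1 / 2) := by
    have : 0 ≤ δ / π ^ 2 := by positivity
    nlinarith [mul_nonneg hC0 (sq_nonneg v)]
  have hC3 : η / 4 ≤ C * (b / 8) := by
    calc η / 4 = 2 * η / b * (b / 8) := by field_simp; norm_num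
      _ ≤ _ := mul_le_mul_of_nonneg_right (le_max_right _ _) (by positivity)
  have hyoung : ∀ p q : ℝ, p * q ≤ π / 2 * p ^ 2 + 1 / (2 * π) * q ^ 2 := by
    intro p q
    have h : π / 2 * p ^ 2 + 1 / (2 * π) * q ^ 2 - p * q = 1 / (2 * π) * (π * p - q) ^ 2 := by
      field_simp
      ring
    have : 0 ≤ 1 / (2 * π) * (π * p - q) ^ 2 := by positivity
    linarith
  have hpoint : ∀ x, y x t * pdt y x t + δ * (y x t) ^ 2 + (η / 4) * (pdx y x t) ^ 4 ≤
      (C * ((1 / 2) * (pdt y x t) ^ 2 + (1 / 2) * (1 - v ^ 2) * (pdx y x t) ^ 2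
        + (b / 8) * (pdx y x t) ^ 4)) +
      ((π / 2 + δ) * (y x t) ^ 2 - (1 / (2 * π) + δ / π ^ 2) * (pdx y x t) ^ 2) := by
    intro x
    have e1 := hyoung (y x t) (pdt y x t)
    have e2 := mul_le_mul_of_nonneg_right hC1 (sq_nonneg (pdx y x t))
    have e3 := mul_le_mul_of_nonneg_right hC2 (sq_nonneg (pdt y x t))
    have e4 := mul_le_mul_of_nonneg_right hC3 (by positivity : 0 ≤ pdx y x t ^ 4)
    linarith
  have hrem : (π / 2 + δ) * (∫ x in (0 : ℝ)..1, y x t ^ 2) ≤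
      (1 / (2 * π) + δ / π ^ 2) * ∫ x in (0 : ℝ)..1, pdx y x t ^ 2 := by
    have h := mul_le_mul_of_nonneg_left hW (by positivity : 0 ≤ 1 / (2 * π) + δ / π ^ 2)
    have e : (1 / (2 * π) + δ / π ^ 2) * π ^ 2 = π / 2 + δ := by field_simp
    rwa [← mul_assoc, e] at h
  have hI : ∀ {g : ℝ → ℝ}, Continuous g → IntervalIntegrable g MeasureTheory.volume 0 1 :=
    fun hg => hg.intervalIntegrable 0 1
  refine (intervalIntegral.integral_mono_on zero_le_one (hI (by fun_prop)) (hI (by fun_prop))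
    fun x _ => hpoint x).trans ?_
  rw [intervalIntegral.integral_add (hI (by fun_prop)) (hI (by fun_prop)),
    intervalIntegral.integral_sub (hI (by fun_prop)) (hI (by fun_prop)),
    intervalIntegral.integral_const_mul, intervalIntegral.integral_const_mul,
    intervalIntegral.integral_const_mul, hE t]
  linarith
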